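/- If G = (X,Y;E) is a bipartite graph with Δ(G) = 6, then χ'_int(G,X) ≤ 17; that is, G has an X-interval coloring using at most 17 colors. -/

import Mathlib

/-- `X` is one part of a bipartition of `G`: every edge joins `X` and its complement. -/
def IsBipartition {V : Type*} (G : SimpleGraph V) (X : Set V) : Prop :=
  ∀ v w, G.Adj v w → (v ∈ X ↔ w ∉ X)

/-- A proper edge coloring: distinct edges sharing a vertex get distinct colors. -/
def IsProperEdgeColoring {V : Type*} (G : SimpleGraph V) (c : G.edgeSet → ℕ) : Prop :=
  ∀ e f : G.edgeSet, e ≠ f → (∃ v, v ∈ (e : Sym2 V) ∧ v ∈ (f : Sym2 V)) → c e ≠ c f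

/-- The palette of a vertex: the set of colors on its incident edges. -/
def palette {V : Type*} (G : SimpleGraph V) (c : G.edgeSet → ℕ) (v : V) : Set ℕ :=
  {n | ∃ e : G.edgeSet, v ∈ (e : Sym2 V) ∧ c e = n}

/-- The coloring is interval at `v`: the palette of `v` is a set of consecutive integers. -/
def IntervalAt {V : Type*} (G : SimpleGraph V) (c : G.edgeSet → ℕ) (v : V) : Prop :=
  ∀ a b m : ℕ, a ∈ palette G c v → b ∈ palette G c v → a ≤ m → m ≤ b →
    m ∈ palette G c v


set_option maxHeartbeats 1000000 in
theorem two_color {E K L : Type*} [DecidableEq E] (s : Finset E) :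
    ∀ (α : E → K) (β : E → L),
    (∀ a ∈ s, ∀ b ∈ s, ∀ c ∈ s, α a = α b → α b = α c → a = b ∨ b = c ∨ a = c) →
    (∀ a ∈ s, ∀ b ∈ s, ∀ c ∈ s, β a = β b → β b = β c → a = b ∨ b = c ∨ a = c) →
    ∃ g : E → Bool, ∀ a ∈ s, ∀ b ∈ s, a ≠ b → (α a = α b ∨ β a = β b) → g a ≠ g b := by
  induction s using Finset.strongInduction with
  | H s ih =>
  intro α β hα hβ
  by_cases h1 : ∃ e ∈ s, ∀ d ∈ s, d ≠ e → α d ≠ α e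
  · obtain ⟨e, he, hd⟩ := h1
    obtain ⟨g, hg⟩ := ih (s.erase e) (Finset.erase_ssubset he) α β
      (fun a ha b hb c hc => hα a (Finset.mem_of_mem_erase ha) b (Finset.mem_of_mem_erase hb)
        c (Finset.mem_of_mem_erase hc))
      (fun a ha b hb c hc => hβ a (Finset.mem_of_mem_erase ha) b (Finset.mem_of_mem_erase hb)
        c (Finset.mem_of_mem_erase hc))
    by_cases h2 : ∃ d ∈ s, d ≠ e ∧ β d = β e
    · obtain ⟨d, hds, hde, hdb⟩ := h2
      refine ⟨Function.update g e (!g d), ?_⟩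
      intro a ha b hb hab h
      have := hg a
      have := hg b
      have := hβ a ha e he d hds
      have := hβ b hb e he d hds
      by_cases hae : a = e <;> by_cases hbe : b = e <;> grind
    · refine ⟨g, ?_⟩
      intro a ha b hb hab h
      by_cases hae : a = e <;> by_cases hbe : b = e <;> grind
  by_cases h1' : ∃ e ∈ s, ∀ d ∈ s, d ≠ e → β d ≠ β e
  · obtain ⟨e, he, hd⟩ := h1'
    obtain ⟨g, hg⟩ := ih (s.erase e) (Finset.erase_ssubset he) α β
      (fun a ha b hb c hc => hα a (Finset.mem_of_mem_erase ha) b (Finset.mem_of_mem_erase hb)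
        c (Finset.mem_of_mem_erase hc))
      (fun a ha b hb c hc => hβ a (Finset.mem_of_mem_erase ha) b (Finset.mem_of_mem_erase hb)
        c (Finset.mem_of_mem_erase hc))
    by_cases h2 : ∃ d ∈ s, d ≠ e ∧ α d = α e
    · obtain ⟨d, hds, hde, hdb⟩ := h2
      refine ⟨Function.update g e (!g d), ?_⟩
      intro a ha b hb hab h
      have := hg a
      have := hg b
      have := hα a ha e he d hds
      have := hα b hb e he d hds
      by_cases hae : a = e <;> by_cases hbe : b = e <;> grind
    · refine ⟨g, ?_⟩
      intro a ha b hb hab h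
      by_cases hae : a = e <;> by_cases hbe : b = e <;> grind
  push Not at h1 h1'
  rcases s.eq_empty_or_nonempty with rfl | ⟨e, he⟩
  · exact ⟨fun _ => true, by simp⟩
  obtain ⟨e', he', hne, hαe⟩ := h1 e he
  obtain ⟨d, hd, hde, hβd⟩ := h1' e he
  obtain ⟨d', hd', hde', hβd'⟩ := h1' e' he'
  have hss : (s.erase e).erase e' ⊂ s :=
    lt_of_le_of_lt (Finset.erase_subset _ _) (Finset.erase_ssubset he)
  have hmem : ∀ a, a ∈ (s.erase e).erase e' ↔ a ≠ e' ∧ a ≠ e ∧ a ∈ s := by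
    intro a; simp
  by_cases hde2 : d = e'
  · subst hde2
    obtain ⟨g, hg⟩ := ih _ hss α β
      (fun a ha b hb c hc => hα a (by grind) b (by grind) c (by grind))
      (fun a ha b hb c hc => hβ a (by grind) b (by grind) c (by grind))
    refine ⟨Function.update (Function.update g e true) d false, ?_⟩
    intro a ha b hb hab h
    have := hg a
    have := hg b
    have := hα a ha e he d hd
    have := hα b hb e he d hd
    have := hβ a ha e he d hd
    have := hβ b hb e he d hd
    by_cases hae : a = e <;> by_cases hbe : b = e <;> by_cases hae' : a = d <;>
      by_cases hbe' : b = d <;> grind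
  · have hd'e : d' ≠ e := by
      have := hβ d hd e he e' he'
      grind
    have hdd : d ≠ d' := by
      have := hβ d hd e he e' he'
      grind
    have hββ : β d ≠ β d' := by
      have := hβ d hd e he e' he'
      grind
    obtain ⟨g, hg⟩ := ih _ hss α (Function.update β d' (β d))
      (fun a ha b hb c hc => hα a (by grind) b (by grind) c (by grind))
      (by
        have key : ∀ a ∈ (s.erase e).erase e', Function.update β d' (β d) a = β d → a = d ∨ a = d' := by
          intro a ha h
          have := hβ a (by grind) d hd e he
          grind
        intro a ha b hb c hc hab hbc
        by_cases hq : Function.update β d' (β d) a = β d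
        · have := key a ha hq
          have := key b hb (by rw [← hab]; exact hq)
          have := key c hc (by rw [← hbc, ← hab]; exact hq)
          grind
        · have := hβ a (by grind) b (by grind) c (by grind)
          have ha' : a ≠ d' := by rintro rfl; simp at hq
          have hb' : b ≠ d' := by rintro rfl; simp at hab; grind
          have hc' : c ≠ d' := by rintro rfl; simp at hbc; grind
          grind)
    have hgd : g d ≠ g d' := hg d (by grind) d' (by grind) hdd (by right; grind)
    refine ⟨Function.update (Function.update g e (!g d)) e' (!g d'), ?_⟩
    have hsym : ∀ a ∈ s, ∀ b ∈ s, a ≠ b → (α a = α b ∨ β a = β b) → b ≠ e → b ≠ e' →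
        Function.update (Function.update g e (!g d)) e' (!g d') a ≠ g b := by
      intro a ha b hb hab h hbe hbe'
      by_cases hae : a = e
      · subst hae
        have h1 : b = d := by
          have := hα b hb a ha e' he'
          have := hβ b hb a ha d hd
          grind
        subst h1
        rw [Function.update_of_ne hne.symm, Function.update_self]; simp
      by_cases hae' : a = e'
      · subst hae'
        have h1 : b = d' := by
          have := hα b hb a ha e he
          have := hβ b hb a ha d' hd'
          grind
        subst h1
        simp
      · rw [Function.update_of_ne hae', Function.update_of_ne hae]
        refine hg a (by grind) b (by grind) hab ?_
        rcases h with h | h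
        · exact Or.inl h
        · right
          have e1 := hβ a ha d' hd' e' he'
          have e2 := hβ b hb d' hd' e' he'
          have : a ≠ d' := by grind
          have : b ≠ d' := by grind
          grind
    have hee : Function.update (Function.update g e (!g d)) e' (!g d') e ≠
        Function.update (Function.update g e (!g d)) e' (!g d') e' := by
      rw [Function.update_self, Function.update_of_ne hne.symm, Function.update_self]
      intro h; exact hgd (by simpa using h)
    have hval : ∀ a, a ≠ e → a ≠ e' →
        Function.update (Function.update g e (!g d)) e' (!g d') a = g a := by
      intro a h1 h2
      rw [Function.update_of_ne h2, Function.update_of_ne h1]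
    generalize Function.update (Function.update g e (!g d)) e' (!g d') = G at *
    clear hg h1 h1' ih hα hβ
    intro a ha b hb hab h
    have h' : α b = α a ∨ β b = β a := h.imp Eq.symm Eq.symm
    have s1 := hsym a ha b hb hab h
    have s2 := hsym b hb a ha hab.symm h'
    have v1 := hval a
    have v2 := hval b
    clear hsym hval hmem hss
    by_cases hae : a = e <;> by_cases hbe : b = e <;> by_cases hae' : a = e' <;>
      by_cases hbe' : b = e' <;> grind

theorem konig3 {E K L : Type*} [DecidableEq E] [DecidableEq K] [DecidableEq L]
    (α : E → K) (β : E → L) (s : Finset E)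
    (hα : ∀ k, (s.filter (fun e => α e = k)).card ≤ 3)
    (hβ : ∀ k, (s.filter (fun e => β e = k)).card ≤ 3) :
    ∃ g : E → Fin 3, ∀ a ∈ s, ∀ b ∈ s, a ≠ b → (α a = α b ∨ β a = β b) → g a ≠ g b := by
  induction s using Finset.induction_on with
  | empty => exact ⟨fun _ => 0, by simp⟩
  | insert e s he ih =>
    obtain ⟨g, hg⟩ := ih
      (fun k => (Finset.card_le_card (Finset.filter_subset_filter _ (Finset.subset_insert _ _))).trans (hα k))
      (fun k => (Finset.card_le_card (Finset.filter_subset_filter _ (Finset.subset_insert _ _))).trans (hβ k))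
    have miss : ∀ t : Finset E, t.card ≤ 2 → ∃ i : Fin 3, ∀ d ∈ t, g d ≠ i := by
      intro t ht
      by_contra hcon
      push Not at hcon
      have : (Finset.univ : Finset (Fin 3)) ⊆ t.image g := by
        intro i _
        obtain ⟨d, hd, h⟩ := hcon i
        exact Finset.mem_image.2 ⟨d, hd, h⟩
      have := Finset.card_le_card this
      have := Finset.card_image_le (s := t) (f := g)
      simp at *
      omega
    obtain ⟨i, hi⟩ := miss (s.filter (fun d => α d = α e)) (by
      have := hα (α e)
      rw [Finset.filter_insert, if_pos rfl, Finset.card_insert_of_notMem (by simp [he])] at this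
      omega)
    obtain ⟨j, hj⟩ := miss (s.filter (fun d => β d = β e)) (by
      have := hβ (β e)
      rw [Finset.filter_insert, if_pos rfl, Finset.card_insert_of_notMem (by simp [he])] at this
      omega)
    simp only [Finset.mem_filter, and_imp] at hi hj
    by_cases hij : i = j
    · subst hij
      refine ⟨Function.update g e i, ?_⟩
      intro a ha b hb hab h
      have := hg a
      have := hg b
      by_cases hae : a = e <;> by_cases hbe : b = e <;> grind
    · obtain ⟨h, hh⟩ := two_color (insert e (s.filter (fun d => g d = i ∨ g d = j))) α β
        (by
          intro a ha b hb c hc hab hbc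
          have := hg a
          have := hg b
          have := hg c
          simp only [Finset.mem_insert, Finset.mem_filter] at ha hb hc
          by_contra hne
          push Not at hne
          grind)
        (by
          intro a ha b hb c hc hab hbc
          have := hg a
          have := hg b
          have := hg c
          simp only [Finset.mem_insert, Finset.mem_filter] at ha hb hc
          by_contra hne
          push Not at hne
          grind)
      refine ⟨fun d => if d = e ∨ g d = i ∨ g d = j then (if h d then i else j) else g d, ?_⟩
      intro a ha b hb hab hk
      have h1 := hg a
      have h2 := hh a
      simp only [Finset.mem_insert, Finset.mem_filter] at ha hb h2
      by_cases hA : a = e ∨ g a = i ∨ g a = j <;> by_cases hB : b = e ∨ g b = i ∨ g b = j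
      · have := h2 (by grind) b (by grind) hab hk
        simp only [if_pos hA, if_pos hB]
        grind
      · simp only [if_pos hA, if_neg hB]
        grind
      · simp only [if_neg hA, if_pos hB]
        grind
      · simp only [if_neg hA, if_neg hB]
        grind
/-- number of elements in the fiber -/
def fdeg {E V : Type*} [Fintype E] [DecidableEq V] (u : E → V) (x : V) : ℕ :=
  (Finset.univ.filter (fun e => u e = x)).card

theorem rank_exists {E V : Type*} [Fintype E] [DecidableEq V] (u : E → V) :
    ∃ r : E → ℕ, (∀ e, r e < fdeg u (u e)) ∧ (∀ e e', u e = u e' → r e = r e' → e = e') ∧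
      ∀ x i, i < fdeg u x → ∃ e, u e = x ∧ r e = i := by
  let q : ∀ x, {e // e ∈ Finset.univ.filter (fun e => u e = x)} ≃ Fin (fdeg u x) :=
    fun x => Finset.equivFin _
  have hq : ∀ e x (h : u e = x), (q (u e) ⟨e, by simp⟩ : ℕ) = q x ⟨e, by simp [h]⟩ := by
    rintro e x rfl; rfl
  refine ⟨fun e => q (u e) ⟨e, by simp⟩, fun e => (q (u e) _).2, ?_, ?_⟩
  · intro e e' h h'
    simp only [hq e (u e') h] at h'
    have := (q (u e')).injective (Fin.ext h')
    simpa using this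
  · intro x i hi
    have hmem := ((q x).symm ⟨i, hi⟩).2
    refine ⟨((q x).symm ⟨i, hi⟩).1, (Finset.mem_filter.1 hmem).2, ?_⟩
    show (q (u _) ⟨_, _⟩ : ℕ) = i
    rw [hq _ x ((Finset.mem_filter.1 hmem).2)]
    simp

theorem card_le_of_inj {E : Type*} [DecidableEq E] (s : Finset E) (f : E → ℕ) (n : ℕ)
    (h1 : ∀ e ∈ s, f e < n) (h2 : ∀ e ∈ s, ∀ e' ∈ s, f e = f e' → e = e') : s.card ≤ n := by
  rw [← Finset.card_range n]
  exact Finset.card_le_card_of_injOn f (by intro e he; simpa using h1 e he)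
    (by intro e he e' he'; exact h2 e he e' he')

theorem card_eq_of_bij {E : Type*} [DecidableEq E] (s : Finset E) (f : E → ℕ) (n : ℕ)
    (h1 : ∀ e ∈ s, f e < n) (h2 : ∀ e ∈ s, ∀ e' ∈ s, f e = f e' → e = e')
    (h3 : ∀ i < n, ∃ e ∈ s, f e = i) : s.card = n := by
  refine le_antisymm (card_le_of_inj s f n h1 h2) ?_
  have : Finset.range n ⊆ s.image f := by
    intro i hi
    obtain ⟨e, he, h⟩ := h3 i (by simpa using hi)
    exact Finset.mem_image.2 ⟨e, he, h⟩
  have := Finset.card_le_card this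
  have := Finset.card_image_le (s := s) (f := f)
  simp at *
  omega

theorem M_exists {E V W : Type*} [Fintype E] [DecidableEq E] [DecidableEq V] [DecidableEq W]
    (u : E → V) (w : E → W) (hu3 : ∀ x, 3 ≤ fdeg u x) (hu : ∀ x, fdeg u x ≤ 6)
    (hw : ∀ y, fdeg w y ≤ 6) :
    ∃ M : E → Bool,
      (∀ x, (Finset.univ.filter (fun e => u e = x ∧ M e = true)).card =
        if fdeg u x = 3 then 1 else 2) ∧
      (∀ y b, (Finset.univ.filter (fun e => w e = y ∧ M e = b)).card ≤ 4) := by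
  obtain ⟨r, hr1, hr2, hr3⟩ := rank_exists u
  obtain ⟨r', hr1', hr2', -⟩ := rank_exists w
  let k : E → ℕ := fun e => if fdeg u (u e) = 4 then r e / 2 else r e / 3
  obtain ⟨g, hg⟩ := konig3 (fun e => (u e, k e)) (fun e => (w e, r' e / 3)) Finset.univ
    (by
      rintro ⟨x, i⟩
      refine card_le_of_inj _ (fun e => if fdeg u x = 4 then r e % 2 else r e % 3) _ ?_ ?_
      · intro e he; split <;> omega
      · intro e he e' he' h
        simp only [Finset.mem_filter, Finset.mem_univ, true_and, Prod.mk.injEq, k] at he he'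
        obtain ⟨rfl, he⟩ := he
        obtain ⟨h1, he'⟩ := he'
        rw [h1] at he'
        refine hr2 _ _ h1.symm ?_
        split at he
        all_goals simp_all
        all_goals omega)
    (by
      rintro ⟨x, i⟩
      refine card_le_of_inj _ (fun e => r' e % 3) _ ?_ ?_
      · intro e he; omega
      · intro e he e' he' h
        simp only [Finset.mem_filter, Finset.mem_univ, true_and, Prod.mk.injEq] at he he' h
        exact hr2' _ _ (he.1.trans he'.1.symm) (by omega))
  simp only [Finset.mem_univ, forall_true_left, Prod.mk.injEq] at hg
  let M : E → Bool := fun e => decide (g e = 0 ∨ (g e = 1 ∧ ∀ e', u e' = u e → k e' = k e → g e' ≠ 0))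
  have hM : ∀ e, M e = true ↔ (g e = 0 ∨ (g e = 1 ∧ ∀ e', u e' = u e → k e' = k e → g e' ≠ 0)) := by
    intro e; simp [M]
  refine ⟨M, ?_, ?_⟩
  · intro x
    refine card_eq_of_bij _ k _ ?_ ?_ ?_
    · intro e he
      simp only [Finset.mem_filter, Finset.mem_univ, true_and] at he
      obtain ⟨rfl, he⟩ := he
      have := hr1 e
      have := hu (u e)
      simp only [k]
      split_ifs <;> omega
    · intro e he e' he' h
      simp only [Finset.mem_filter, Finset.mem_univ, true_and, hM] at he he'
      obtain ⟨rfl, he⟩ := he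
      obtain ⟨h1, he'⟩ := he'
      by_contra hne
      have h2 := hg e e' hne (Or.inl ⟨h1.symm, h⟩)
      rcases he with he | ⟨he, h3⟩ <;> rcases he' with he' | ⟨he', h4⟩
      · exact h2 (he.trans he'.symm)
      · exact h4 e h1.symm h he
      · exact h3 e' h1 h.symm he'
      · exact h2 (he.trans he'.symm)
    · intro i hi
      have h3 := hu3 x
      obtain ⟨a, b, ha, hb, hab, hka, hkb⟩ : ∃ a b, u a = x ∧ u b = x ∧ a ≠ b ∧ k a = i ∧ k b = i := by
        obtain ⟨j, hj, hj1, hj2⟩ : ∃ j, j + 1 < fdeg u x ∧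
            (if fdeg u x = 4 then j / 2 else j / 3) = i ∧
            (if fdeg u x = 4 then (j+1) / 2 else (j+1) / 3) = i := by
          have := hu x
          refine ⟨if fdeg u x = 4 then 2 * i else 3 * i, ?_⟩
          split_ifs at * <;> omega
        obtain ⟨a, ha, hra⟩ := hr3 x j (by omega)
        obtain ⟨b, hb, hrb⟩ := hr3 x (j+1) hj
        refine ⟨a, b, ha, hb, by rintro rfl; omega, ?_, ?_⟩
        · simp only [k, ha, hra]; exact hj1
        · simp only [k, hb, hrb]; exact hj2
      by_cases h0 : ∃ e, u e = x ∧ k e = i ∧ g e = 0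
      · obtain ⟨e, h1, h2, h3⟩ := h0
        exact ⟨e, by simp [hM, h1, h3], h2⟩
      · push Not at h0
        have hne := hg a b hab (Or.inl ⟨ha.trans hb.symm, hka.trans hkb.symm⟩)
        have h01 := h0 a ha hka
        have h02 := h0 b hb hkb
        have : g a = 1 ∨ g b = 1 := by
          generalize g a = p at *
          generalize g b = q at *
          revert p q; decide
        rcases this with h | h
        · refine ⟨a, ?_, hka⟩
          simp only [Finset.mem_filter, Finset.mem_univ, true_and, hM]
          exact ⟨ha, Or.inr ⟨h, fun e' h1 h2 => h0 e' (h1.trans ha) (h2.trans hka)⟩⟩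
        · refine ⟨b, ?_, hkb⟩
          simp only [Finset.mem_filter, Finset.mem_univ, true_and, hM]
          exact ⟨hb, Or.inr ⟨h, fun e' h1 h2 => h0 e' (h1.trans hb) (h2.trans hkb)⟩⟩
  · intro y b
    refine card_le_of_inj _ (fun e => 2 * (r' e / 3) + (if b then (g e : ℕ) else 2 - (g e : ℕ))) _ ?_ ?_
    · intro e he
      simp only [Finset.mem_filter, Finset.mem_univ, true_and] at he
      have := hr1' e
      have := hw (w e)
      cases b
      · have : g e ≠ 0 := by
          intro h
          have := (hM e).2 (Or.inl h)
          simp [he.2] at this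
        have : (g e : ℕ) ≠ 0 := fun h => this (Fin.ext h)
        simp only [Bool.false_eq_true, if_false]
        omega
      · have := (hM e).1 he.2
        have : (g e : ℕ) ≤ 1 := by
          rcases this with h | h
          · rw [h]; decide
          · rw [h.1]; decide
        simp only [if_true]
        omega
    · intro e he e' he' h
      simp only [Finset.mem_filter, Finset.mem_univ, true_and] at he he' h
      by_contra hne
      have h0 : ∀ e, M e = false → (g e : ℕ) ≠ 0 := by
        intro e he h
        have := (hM e).2 (Or.inl (Fin.ext h))
        simp [he] at this
      have h1 : ∀ e, M e = true → (g e : ℕ) ≤ 1 := by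
        intro e he
        rcases (hM e).1 he with h | h
        · rw [h]; decide
        · rw [h.1]; decide
      have h2 := (g e).2
      have h3 := (g e').2
      have key : r' e / 3 = r' e' / 3 ∧ (g e : ℕ) = g e' := by
        cases b
        · have := h0 e he.2
          have := h0 e' he'.2
          simp only [Bool.false_eq_true, if_false] at h
          omega
        · have := h1 e he.2
          have := h1 e' he'.2
          simp only [if_true] at h
          omega
      exact hg e e' hne (Or.inr ⟨he.1.trans he'.1.symm, key.1⟩) (Fin.ext key.2)
/-- Two colours are balanced on a finite set. -/
def Bal {E : Type*} (g : E → Bool) (s : Finset E) : Prop :=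
  (s.filter (fun e => g e = true)).card ≤ (s.filter (fun e => g e = false)).card + 1 ∧
  (s.filter (fun e => g e = false)).card ≤ (s.filter (fun e => g e = true)).card + 1

theorem Bal.small {E : Type*} (g : E → Bool) (s : Finset E) (h : s.card ≤ 1) : Bal g s := by
  have h1 := Finset.card_filter_le s (fun e => g e = true)
  have h2 := Finset.card_filter_le s (fun e => g e = false)
  constructor <;> omega

theorem Bal.insert_pair {E : Type*} [DecidableEq E] (g : E → Bool) (s : Finset E) (a b : E)
    (ha : a ∉ s) (hb : b ∉ s) (_hab : a ≠ b) (hg : g a ≠ g b) (h : Bal g s) :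
    Bal g (insert a (insert b s)) := by
  unfold Bal at *
  rw [Finset.filter_insert, Finset.filter_insert, Finset.filter_insert, Finset.filter_insert]
  cases hga : g a <;> cases hgb : g b <;> simp_all

theorem pairing {E : Type*} [DecidableEq E] (lab : E → Bool) (T : Finset E) :
    ∃ k : E → ℕ, (∀ a ∈ T, ∀ b ∈ T, ∀ c ∈ T, k a = k b → k b = k c → a = b ∨ b = c ∨ a = c) ∧
      ∀ g : E → Bool, (∀ a ∈ T, ∀ b ∈ T, a ≠ b → k a = k b → g a ≠ g b) →
        Bal g T ∧ ∀ m, Bal g (T.filter (fun e => lab e = m)) := by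
  induction T using Finset.strongInduction with
  | H T ih =>
  by_cases h : ∃ a ∈ T, ∃ b ∈ T, a ≠ b ∧ lab a = lab b
  · obtain ⟨a, ha, b, hb, hab, hl⟩ := h
    have hss : (T.erase a).erase b ⊂ T :=
      lt_of_le_of_lt (Finset.erase_subset _ _) (Finset.erase_ssubset ha)
    obtain ⟨k, hk1, hk2⟩ := ih _ hss
    have hmem : ∀ c, c ∈ (T.erase a).erase b ↔ c ≠ b ∧ c ≠ a ∧ c ∈ T := by
      intro c; simp
    have hT : T = insert a (insert b ((T.erase a).erase b)) := by
      ext c; simp only [Finset.mem_insert, hmem]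
      by_cases h1 : c = a <;> by_cases h2 : c = b <;> simp_all
    refine ⟨fun e => if e = a ∨ e = b then 0 else k e + 1, ?_, ?_⟩
    · intro c hc d hd e he h1 h2
      have := hk1 c
      simp only [hmem] at this
      by_cases hca : c = a ∨ c = b
      · grind
      · by_cases hda : d = a ∨ d = b
        · grind
        · by_cases hea : e = a ∨ e = b
          · grind
          · simp only [hca, hda, hea, if_false] at h1 h2
            push Not at hca hda hea
            exact this ⟨hca.2, hca.1, hc⟩ d ⟨hda.2, hda.1, hd⟩ e ⟨hea.2, hea.1, he⟩
              (by omega) (by omega)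
    · intro g hg
      have hgab : g a ≠ g b := hg a ha b hb hab (by simp)
      obtain ⟨h1, h2⟩ := hk2 g (by
        intro c hc d hd hcd h
        rw [hmem] at hc hd
        refine hg c hc.2.2 d hd.2.2 hcd ?_
        simp [hc.1, hc.2.1, hd.1, hd.2.1, h])
      refine ⟨?_, ?_⟩
      · rw [hT]
        exact Bal.insert_pair g _ a b (by simp) (by simp) hab hgab h1
      · intro m
        rw [hT, Finset.filter_insert, Finset.filter_insert, ← hl]
        split_ifs
        · exact Bal.insert_pair g _ a b (by simp) (by simp) hab hgab (h2 m)
        · exact h2 m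
  · push Not at h
    have hc : ∀ a ∈ T, ∀ b ∈ T, ∀ c ∈ T, a = b ∨ b = c ∨ a = c := by
      intro a ha b hb c hc
      have h1 := h a ha b hb
      have h2 := h b hb c hc
      have h3 := h a ha c hc
      by_contra hcon
      push Not at hcon
      have h1 := h1 hcon.1
      have h2 := h2 hcon.2.1
      have h3 := h3 hcon.2.2
      revert h1 h2 h3
      cases lab a <;> cases lab b <;> cases lab c <;> simp
    refine ⟨fun _ => 0, fun a ha b hb c hc' _ _ => hc a ha b hb c hc', ?_⟩
    intro g hg
    constructor
    · rcases Nat.lt_or_ge 1 T.card with h1 | h1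
      · obtain ⟨a, ha, b, hb, hab⟩ := Finset.one_lt_card.1 h1
        have hT : T = insert a (insert b ∅) := by
          ext c
          simp only [Finset.mem_insert, Finset.notMem_empty, or_false]
          constructor
          · intro h; have := hc a ha b hb c h; grind
          · rintro (rfl | rfl) <;> assumption
        rw [hT]
        exact Bal.insert_pair g _ a b (by simp) (by simp) hab (hg a ha b hb hab rfl)
          (Bal.small _ _ (by simp))
      · exact Bal.small _ _ h1
    · intro m
      refine Bal.small _ _ ?_
      rw [Finset.card_le_one]
      intro a ha b hb
      simp only [Finset.mem_filter] at ha hb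
      by_contra hne
      exact h a ha.1 b hb.1 hne (ha.2.trans hb.2.symm)

/-- count of edges at a vertex with given marks -/
def cnt {E V : Type*} [Fintype E] [DecidableEq V] (u : E → V) (M F : E → Bool) (x : V)
    (m f : Bool) : ℕ :=
  (Finset.univ.filter (fun e => u e = x ∧ M e = m ∧ F e = f)).card

theorem split_exists {E V W : Type*} [Fintype E] [DecidableEq E] [DecidableEq V] [DecidableEq W]
    (u : E → V) (w : E → W) (M : E → Bool) :
    ∃ F : E → Bool,
      (∀ x, Bal F (Finset.univ.filter (fun e => u e = x)) ∧
        ∀ m, Bal F (Finset.univ.filter (fun e => u e = x ∧ M e = m))) ∧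
      (∀ y, Bal F (Finset.univ.filter (fun e => w e = y)) ∧
        ∀ m, Bal F (Finset.univ.filter (fun e => w e = y ∧ M e = m))) := by
  choose ku hu1 hu2 using fun x => pairing M (Finset.univ.filter (fun e => u e = x))
  choose kw hw1 hw2 using fun y => pairing M (Finset.univ.filter (fun e => w e = y))
  obtain ⟨F, hF⟩ := two_color Finset.univ (fun e => (u e, ku (u e) e)) (fun e => (w e, kw (w e) e))
    (by
      intro a _ b _ c _ h1 h2
      simp only [Prod.mk.injEq] at h1 h2
      have h3 := h1.1
      have h4 := h2.1
      refine hu1 (u b) a (by simp [h3]) b (by simp) c (by simp [h4]) ?_ ?_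
      · rw [← h1.2, h3]
      · rw [h2.2, h4])
    (by
      intro a _ b _ c _ h1 h2
      simp only [Prod.mk.injEq] at h1 h2
      have h3 := h1.1
      have h4 := h2.1
      refine hw1 (w b) a (by simp [h3]) b (by simp) c (by simp [h4]) ?_ ?_
      · rw [← h1.2, h3]
      · rw [h2.2, h4])
  simp only [Finset.mem_univ, forall_true_left, Prod.mk.injEq] at hF
  refine ⟨F, ?_, ?_⟩
  · intro x
    have := hu2 x F (by
      intro a ha b hb hab h
      simp only [Finset.mem_filter, Finset.mem_univ, true_and] at ha hb
      exact hF a b hab (Or.inl ⟨ha.trans hb.symm, by rw [ha, hb]; exact h⟩))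
    simpa only [Finset.filter_filter] using this
  · intro x
    have := hw2 x F (by
      intro a ha b hb hab h
      simp only [Finset.mem_filter, Finset.mem_univ, true_and] at ha hb
      exact hF a b hab (Or.inr ⟨ha.trans hb.symm, by rw [ha, hb]; exact h⟩))
    simpa only [Finset.filter_filter] using this

/-- admissible states -/
def St {E V W : Type*} [Fintype E] [DecidableEq V] [DecidableEq W]
    (u : E → V) (w : E → W) (M F : E → Bool) : Prop :=
  (∀ x, (fdeg u x = 6 ∧ cnt u M F x true false = 1 ∧ cnt u M F x true true = 1 ∧
          cnt u M F x false false = 2 ∧ cnt u M F x false true = 2) ∨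
        (fdeg u x = 5 ∧ cnt u M F x true false = 1 ∧ cnt u M F x true true = 1 ∧
          cnt u M F x false false = 2 ∧ cnt u M F x false true = 1) ∨
        (fdeg u x = 5 ∧ cnt u M F x true false = 1 ∧ cnt u M F x true true = 1 ∧
          cnt u M F x false false = 1 ∧ cnt u M F x false true = 2) ∨
        (fdeg u x = 5 ∧ cnt u M F x true false = 0 ∧ cnt u M F x true true = 1 ∧
          cnt u M F x false false = 2 ∧ cnt u M F x false true = 2) ∨
        (fdeg u x = 4 ∧ cnt u M F x true false = 1 ∧ cnt u M F x true true = 1 ∧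
          cnt u M F x false false = 1 ∧ cnt u M F x false true = 1) ∨
        (fdeg u x = 3 ∧ cnt u M F x true false = 1 ∧ cnt u M F x true true = 0 ∧
          cnt u M F x false false = 1 ∧ cnt u M F x false true = 1) ∨
        (fdeg u x = 3 ∧ cnt u M F x true false = 0 ∧ cnt u M F x true true = 1 ∧
          cnt u M F x false false = 1 ∧ cnt u M F x false true = 1)) ∧
  (∀ y, cnt w M F y true false ≤ 2 ∧ cnt w M F y true true ≤ 2 ∧
        cnt w M F y false false ≤ 2 ∧ cnt w M F y false true ≤ 2 ∧
        cnt w M F y true false + cnt w M F y false false ≤ 3)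

theorem bal_cnt {E V : Type*} [Fintype E] [DecidableEq E] [DecidableEq V] (u : E → V)
    (M F : E → Bool) (x : V) (m : Bool)
    (h : Bal F (Finset.univ.filter (fun e => u e = x ∧ M e = m))) :
    cnt u M F x m true ≤ cnt u M F x m false + 1 ∧ cnt u M F x m false ≤ cnt u M F x m true + 1 ∧
    (Finset.univ.filter (fun e => u e = x ∧ M e = m)).card = cnt u M F x m true + cnt u M F x m false := by
  have e1 : ∀ f, cnt u M F x m f =
      ((Finset.univ.filter (fun e => u e = x ∧ M e = m)).filter (fun e => F e = f)).card := by
    intro f; simp only [cnt, Finset.filter_filter, and_assoc]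
  rw [e1, e1]
  refine ⟨h.1, h.2, ?_⟩
  rw [← Finset.card_filter_add_card_filter_not (fun e => F e = true)]
  simp

theorem bal_fdeg {E V : Type*} [Fintype E] [DecidableEq E] [DecidableEq V] (u : E → V)
    (M F : E → Bool) (x : V)
    (h : Bal F (Finset.univ.filter (fun e => u e = x))) :
    cnt u M F x true true + cnt u M F x false true
      ≤ cnt u M F x true false + cnt u M F x false false + 1 ∧
    cnt u M F x true false + cnt u M F x false false
      ≤ cnt u M F x true true + cnt u M F x false true + 1 ∧
    fdeg u x = cnt u M F x true true + cnt u M F x false true + cnt u M F x true false +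
      cnt u M F x false false := by
  have e1 : ∀ f, cnt u M F x true f + cnt u M F x false f =
      ((Finset.univ.filter (fun e => u e = x)).filter (fun e => F e = f)).card := by
    intro f
    rw [← Finset.card_filter_add_card_filter_not (s := (Finset.univ.filter (fun e => u e = x)).filter (fun e => F e = f)) (fun e => M e = true)]
    simp only [cnt, Finset.filter_filter, and_assoc, Bool.not_eq_true]
    congr 2 <;> ext e <;> simp <;> tauto
  rw [e1, e1]
  refine ⟨h.1, h.2, ?_⟩
  have := e1 true
  have := e1 false
  have h3 := Finset.card_filter_add_card_filter_not (s := (Finset.univ.filter (fun e => u e = x))) (fun e => F e = true)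
  simp only [Bool.not_eq_true] at h3
  unfold fdeg
  omega

theorem St_exists {E V W : Type*} [Fintype E] [DecidableEq E] [DecidableEq V] [DecidableEq W]
    (u : E → V) (w : E → W) (hu3 : ∀ x, 3 ≤ fdeg u x) (hu : ∀ x, fdeg u x ≤ 6)
    (hw : ∀ y, fdeg w y ≤ 6) : ∃ M F, St u w M F := by
  obtain ⟨M, hM1, hM2⟩ := M_exists u w hu3 hu hw
  obtain ⟨F, hF1, hF2⟩ := split_exists u w M
  refine ⟨M, F, ?_, ?_⟩
  · intro x
    obtain ⟨h1, h2⟩ := hF1 x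
    have a1 := bal_cnt u M F x true (h2 true)
    have a2 := bal_cnt u M F x false (h2 false)
    have a3 := bal_fdeg u M F x h1
    have a4 := hM1 x
    have := hu3 x
    have := hu x
    obtain ⟨a11, a12, a13⟩ := a1
    obtain ⟨a21, a22, a23⟩ := a2
    obtain ⟨a31, a32, a33⟩ := a3
    rw [a13] at a4
    clear a13 a23 hM1 hM2 hF1 hF2 hu3 hu hw h1 h2
    generalize cnt u M F x true true = p at *
    generalize cnt u M F x true false = q at *
    generalize cnt u M F x false true = r at *
    generalize cnt u M F x false false = t at *
    generalize fdeg u x = d at *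
    have hd : d = 3 ∨ d = 4 ∨ d = 5 ∨ d = 6 := by omega
    rcases hd with rfl | rfl | rfl | rfl
    · simp only [if_true] at a4
      by_cases hp : p = 1
      · exact Or.inr <| Or.inr <| Or.inr <| Or.inr <| Or.inr <| Or.inr ⟨rfl, by omega, by omega, by omega, by omega⟩
      · exact Or.inr <| Or.inr <| Or.inr <| Or.inr <| Or.inr <| Or.inl ⟨rfl, by omega, by omega, by omega, by omega⟩
    · simp at a4
      exact Or.inr <| Or.inr <| Or.inr <| Or.inr <| Or.inl ⟨rfl, by omega, by omega, by omega, by omega⟩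
    · simp at a4
      by_cases hp : t = 2
      · exact Or.inr <| Or.inl ⟨rfl, by omega, by omega, by omega, by omega⟩
      · exact Or.inr <| Or.inr <| Or.inl ⟨rfl, by omega, by omega, by omega, by omega⟩
    · simp at a4
      exact Or.inl ⟨rfl, by omega, by omega, by omega, by omega⟩
  · intro y
    obtain ⟨h1, h2⟩ := hF2 y
    have a1 := bal_cnt w M F y true (h2 true)
    have a2 := bal_cnt w M F y false (h2 false)
    have a3 := bal_fdeg w M F y h1
    have a4 := hM2 y true
    have a5 := hM2 y false
    have := hw y
    omega

theorem cnt_drop {E V : Type*} [Fintype E] [DecidableEq E] [DecidableEq V] (u : E → V)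
    (M F : E → Bool) (e : E) (hM : M e = true) (hF : F e = false) (x : V) :
    cnt u (Function.update M e false) F x true true = cnt u M F x true true ∧
    cnt u (Function.update M e false) F x false true = cnt u M F x false true ∧
    (u e ≠ x → cnt u (Function.update M e false) F x true false = cnt u M F x true false ∧
      cnt u (Function.update M e false) F x false false = cnt u M F x false false) ∧
    (u e = x → cnt u (Function.update M e false) F x true false + 1 = cnt u M F x true false ∧
      cnt u (Function.update M e false) F x false false = cnt u M F x false false + 1) := by
  have hup : ∀ d, Function.update M e false d = if d = e then false else M d := by
    intro d; by_cases h : d = e <;> simp [h]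
  refine ⟨?_, ?_, ?_, ?_⟩
  · unfold cnt; congr 1; ext d
    simp only [hup, Finset.mem_filter, Finset.mem_univ, true_and]
    by_cases h : d = e
    · subst h; simp [hF]
    · simp [h]
  · unfold cnt; congr 1; ext d
    simp only [hup, Finset.mem_filter, Finset.mem_univ, true_and]
    by_cases h : d = e
    · subst h; simp [hF]
    · simp [h]
  · intro hx
    constructor <;>
    · unfold cnt; congr 1; ext d
      simp only [hup, Finset.mem_filter, Finset.mem_univ, true_and]
      by_cases h : d = e
      · subst h; simp [hx]
      · simp [h]
  · intro hx
    constructor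
    · unfold cnt
      rw [← Finset.card_erase_add_one (s := Finset.univ.filter (fun e => u e = x ∧ M e = true ∧ F e = false)) (a := e) (by simp [hx, hM, hF])]
      congr 2; ext d
      simp only [hup, Finset.mem_filter, Finset.mem_univ, true_and, Finset.mem_erase]
      by_cases h : d = e
      · subst h; simp
      · simp [h]
    · unfold cnt
      rw [← Finset.card_insert_of_notMem (s := Finset.univ.filter (fun e => u e = x ∧ M e = false ∧ F e = false)) (a := e) (by simp [hM])]
      congr 1; ext d
      simp only [hup, Finset.mem_filter, Finset.mem_univ, true_and, Finset.mem_insert]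
      by_cases h : d = e
      · subst h; simp [hx, hF]
      · simp [h]

theorem St_min {E V W : Type*} [Fintype E] [DecidableEq E] [DecidableEq V] [DecidableEq W]
    (u : E → V) (w : E → W) (F : E → Bool) (n : ℕ) :
    ∀ M, (Finset.univ.filter (fun e => M e = true)).card = n → St u w M F →
    ∃ M, St u w M F ∧ ∀ e, M e = true → F e = false → fdeg u (u e) = 5 →
      cnt u M F (u e) false true = 2 → cnt w M F (w e) true false ≤ 1 := by
  induction n using Nat.strong_induction_on with
  | _ n ih =>
  intro M hn hS
  by_cases h : ∀ e, M e = true → F e = false → fdeg u (u e) = 5 →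
      cnt u M F (u e) false true = 2 → cnt w M F (w e) true false ≤ 1
  · exact ⟨M, hS, h⟩
  push Not at h
  obtain ⟨e, hM, hF, h5, h2, hy⟩ := h
  refine ih _ ?_ (Function.update M e false) rfl ?_
  · rw [← hn]
    apply Finset.card_lt_card
    rw [Finset.ssubset_iff_of_subset]
    · exact ⟨e, by simp [hM], by simp⟩
    · intro d
      by_cases h : d = e
      · subst h; simp
      · simp [h]
  · refine ⟨?_, ?_⟩
    · intro x
      obtain ⟨c1, c2, c3, c4⟩ := cnt_drop u M F e hM hF x
      have := hS.1 x
      by_cases hx : u e = x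
      · obtain ⟨c5, c6⟩ := c4 hx
        rw [hx] at h5 h2
        refine Or.inr <| Or.inr <| Or.inr <| Or.inl ⟨h5, ?_⟩
        rcases this with h | h | h | h | h | h | h <;>
          obtain ⟨h0, h1, h2', h3, h4⟩ := h <;> refine ⟨?_, ?_, ?_, ?_⟩ <;> omega
      · obtain ⟨c5, c6⟩ := c3 hx
        rw [c1, c2, c5, c6]
        exact this
    · intro y
      obtain ⟨c1, c2, c3, c4⟩ := cnt_drop w M F e hM hF y
      have := hS.2 y
      by_cases hx : w e = y
      · obtain ⟨c5, c6⟩ := c4 hx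
        rw [hx] at hy
        omega
      · obtain ⟨c5, c6⟩ := c3 hx
        rw [c1, c2, c5, c6]
        exact this
/-- position of label `l` in the window starting at `S` -/
def pos (l S : ℕ) : ℕ := S + (l + 18 - S) % 6

/-- `S` is a valid window start at `x` -/
def Vd {E V : Type*} [Fintype E] [DecidableEq V] (u : E → V) (lam : E → ℕ) (x : V) (S : ℕ) : Prop :=
  S + fdeg u x ≤ 17 ∧ ∀ e, u e = x → (lam e + 18 - S) % 6 < fdeg u x

theorem pos_mod {l S : ℕ} (h : S ≤ 17) : pos l S % 6 = l % 6 := by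
  unfold pos; omega

/-- The label `l` has no partner at the vertices joined to `x`. -/
def Alone {E V W : Type*} (u : E → V) (w : E → W) (lam : E → ℕ) (l : ℕ) (x : V) : Prop :=
  ∀ e, u e = x → lam e = l → ∀ e', w e' = w e → lam e' = l → e' = e

theorem lift_base {E V W : Type*} [Fintype E] [DecidableEq E] [DecidableEq V]
    [DecidableEq W] [Fintype V]
    (u : E → V) (w : E → W) (lam : E → ℕ)
    (hinj : ∀ e e', u e = u e' → lam e = lam e' → e = e')
    (hy : ∀ e e', w e = w e' → lam e = lam e' → e ≠ e' → lam e = 1 ∨ lam e = 4)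
    (hy2 : ∀ a b c, w a = w b → w b = w c → lam a = lam b → lam b = lam c → a = b ∨ b = c ∨ a = c)
    (A : Finset V)
    (hA : ∀ x ∈ A, ∃ S, (S = 3 ∨ S = 4) ∧ Vd u lam x S ∧ Vd u lam x (S + 6)) :
    ∃ S : V → ℕ, (∀ x ∈ A, Vd u lam x (S x)) ∧
      ∀ e e', u e ∈ A → u e' ∈ A → e ≠ e' → w e = w e' → lam e = lam e' →
        pos (lam e) (S (u e)) ≠ pos (lam e') (S (u e')) := by
  classical
  choose! S0 h0 h1 h2 using hA
  let key : ℕ → V → W ⊕ V := fun l x =>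
    if h : ∃ e, u e = x ∧ lam e = l then Sum.inl (w h.choose) else Sum.inr x
  have hkey : ∀ l e, lam e = l → key l (u e) = Sum.inl (w e) := by
    intro l e he
    have h : ∃ e', u e' = u e ∧ lam e' = l := ⟨e, rfl, he⟩
    simp only [key, dif_pos h]
    rw [hinj _ _ h.choose_spec.1 (h.choose_spec.2.trans he.symm)]
  have hfib : ∀ l a b c, key l a = key l b → key l b = key l c → a = b ∨ b = c ∨ a = c := by
    intro l a b c hab hbc
    by_cases ha : ∃ e, u e = a ∧ lam e = l
    · obtain ⟨ea, rfl, hea⟩ := ha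
      rw [hkey l ea hea] at hab
      by_cases hb : ∃ e, u e = b ∧ lam e = l
      · obtain ⟨eb, rfl, heb⟩ := hb
        rw [hkey l eb heb] at hab hbc
        by_cases hc : ∃ e, u e = c ∧ lam e = l
        · obtain ⟨ec, rfl, hec⟩ := hc
          rw [hkey l ec hec] at hbc
          rcases hy2 ea eb ec (Sum.inl_injective hab) (Sum.inl_injective hbc)
            (hea.trans heb.symm) (heb.trans hec.symm) with h | h | h
          · left; rw [h]
          · right; left; rw [h]
          · right; right; rw [h]
        · simp [key, dif_neg hc] at hbc
      · simp [key, dif_neg hb] at hab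
    · have e1 : key l a = Sum.inr a := by simp only [key, dif_neg ha]
      by_cases hb : ∃ e, u e = b ∧ lam e = l
      · obtain ⟨eb, rfl, heb⟩ := hb
        rw [hkey l eb heb, e1] at hab
        simp at hab
      · have e2 : key l b = Sum.inr b := by simp only [key, dif_neg hb]
        rw [e1, e2] at hab
        left; exact Sum.inr_injective hab
  obtain ⟨t, ht⟩ := two_color A (key 1) (key 4) (fun a _ b _ c _ => hfib 1 a b c)
    (fun a _ b _ c _ => hfib 4 a b c)
  refine ⟨fun x => if t x then S0 x else S0 x + 6, ?_, ?_⟩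
  · intro x hx
    dsimp only
    split_ifs
    · exact h1 x hx
    · exact h2 x hx
  · intro e e' he he' hne hw hl
    have hu : u e ≠ u e' := fun h => hne (hinj _ _ h hl)
    have hl14 := hy e e' hw hl hne
    have htt : t (u e) ≠ t (u e') := by
      refine ht _ he _ he' hu ?_
      rcases hl14 with h | h
      · left; rw [hkey 1 e h, hkey 1 e' (hl ▸ h), hw]
      · right; rw [hkey 4 e h, hkey 4 e' (hl ▸ h), hw]
    rw [← hl]
    have a1 := h0 _ he
    have a2 := h0 _ he'
    unfold pos
    cases h3 : t (u e) <;> cases h4 : t (u e') <;> simp only [h3, h4] at htt ⊢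
    · exact absurd rfl htt
    · simp only [Bool.false_eq_true, if_false, if_true]
      rcases hl14 with h | h <;> rw [h] <;> omega
    · simp only [Bool.false_eq_true, if_false, if_true]
      rcases hl14 with h | h <;> rw [h] <;> omega
    · exact absurd rfl htt

theorem lift {E V W : Type*} [Fintype E] [DecidableEq E] [DecidableEq V]
    [DecidableEq W] [Fintype V]
    (u : E → V) (w : E → W) (lam : E → ℕ) (hlt : ∀ e, lam e < 6)
    (hinj : ∀ e e', u e = u e' → lam e = lam e' → e = e')
    (hy : ∀ e e', w e = w e' → lam e = lam e' → e ≠ e' → lam e = 1 ∨ lam e = 4)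
    (hy2 : ∀ a b c, w a = w b → w b = w c → lam a = lam b → lam b = lam c → a = b ∨ b = c ∨ a = c)
    (htype : ∀ x,
      (∀ a b, ∃ S, Vd u lam x S ∧ pos 1 S ≠ a ∧ pos 4 S ≠ b) ∨
      (∃ S, Vd u lam x S ∧ Vd u lam x (S + 6) ∧ (Alone u w lam 1 x ∨ Alone u w lam 4 x)) ∨
      (∃ S, (S = 3 ∨ S = 4) ∧ Vd u lam x S ∧ Vd u lam x (S + 6))) :
    ∃ c : E → ℕ, (∀ e, c e < 17) ∧ (∀ e e', e ≠ e' → (u e = u e' ∨ w e = w e') → c e ≠ c e') ∧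
      (∀ e e' m, u e = u e' → c e ≤ m → m ≤ c e' → ∃ d, u d = u e ∧ c d = m) := by
  classical
  have main : ∀ T : Finset V, ∃ S : V → ℕ,
      (∀ x ∈ (Finset.univ.filter (fun x => ∃ S, (S = 3 ∨ S = 4) ∧ Vd u lam x S ∧ Vd u lam x (S + 6))) ∪ T,
        Vd u lam x (S x)) ∧
      ∀ e e', u e ∈ (Finset.univ.filter (fun x => ∃ S, (S = 3 ∨ S = 4) ∧ Vd u lam x S ∧ Vd u lam x (S + 6))) ∪ T →
        u e' ∈ (Finset.univ.filter (fun x => ∃ S, (S = 3 ∨ S = 4) ∧ Vd u lam x S ∧ Vd u lam x (S + 6))) ∪ T →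
        e ≠ e' → w e = w e' → lam e = lam e' →
        pos (lam e) (S (u e)) ≠ pos (lam e') (S (u e')) := by
    intro T
    induction T using Finset.induction_on with
    | empty =>
      rw [Finset.union_empty]
      exact lift_base u w lam hinj hy hy2 _ (fun x hx => by simpa using hx)
    | insert x T hx ih =>
      rw [Finset.union_insert]
      generalize hA : (Finset.univ.filter (fun x => ∃ S, (S = 3 ∨ S = 4) ∧ Vd u lam x S ∧ Vd u lam x (S + 6))) ∪ T = A at ih ⊢
      obtain ⟨S, hS1, hS2⟩ := ih
      by_cases hxA : x ∈ A
      · rw [Finset.insert_eq_of_mem hxA]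
        exact ⟨S, hS1, hS2⟩
      have hpart : ∀ l, ∃ a, ∀ e e', u e = x → lam e = l → e' ≠ e → w e' = w e → lam e' = l →
          pos l (S (u e')) = a := by
        intro l
        by_cases h : ∃ e e', u e = x ∧ lam e = l ∧ e' ≠ e ∧ w e' = w e ∧ lam e' = l
        · obtain ⟨e, e', h1, h2, h3, h4, h5⟩ := h
          refine ⟨pos l (S (u e')), ?_⟩
          intro d d' g1 g2 g3 g4 g5
          have : d = e := hinj _ _ (g1.trans h1.symm) (g2.trans h2.symm)
          subst this
          rcases hy2 d' e' d (g4.trans h4.symm) h4 (g5.trans h5.symm) (h5.trans h2.symm) with h | h | h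
          · rw [h]
          · exact absurd h h3
          · exact absurd h g3
        · refine ⟨0, ?_⟩
          intro d d' g1 g2 g3 g4 g5
          exact absurd ⟨d, d', g1, g2, g3, g4, g5⟩ h
      obtain ⟨a, ha⟩ := hpart 1
      obtain ⟨b, hb⟩ := hpart 4
      obtain ⟨s, hs, hs1⟩ : ∃ s, Vd u lam x s ∧ ∀ e e', u e = x → e' ≠ e → w e' = w e →
          lam e' = lam e → pos (lam e) (S (u e')) ≠ pos (lam e) s := by
        rcases htype x with h | ⟨s, h1, h2, h3⟩ | h
        · obtain ⟨s, h1, h2, h3⟩ := h a b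
          refine ⟨s, h1, ?_⟩
          intro e e' g1 g2 g3 g4
          rcases hy e' e g3 g4 g2 with h | h
          · rw [← g4, h, ha e e' g1 (g4.symm.trans h) g2 g3 h]; exact h2.symm
          · rw [← g4, h, hb e e' g1 (g4.symm.trans h) g2 g3 h]; exact h3.symm
        · have p1 : pos 1 (s+6) = pos 1 s + 6 := by
            have := h2.1
            unfold pos; omega
          have p4 : pos 4 (s+6) = pos 4 s + 6 := by
            have := h2.1
            unfold pos; omega
          rcases h3 with h3 | h3
          · obtain ⟨s', g1, g2⟩ : ∃ s', Vd u lam x s' ∧ pos 4 s' ≠ b := by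
              by_cases h : pos 4 s = b
              · exact ⟨s + 6, h2, by omega⟩
              · exact ⟨s, h1, h⟩
            refine ⟨s', g1, ?_⟩
            intro e e' f1 f2 f3 f4
            rcases hy e' e f3 f4 f2 with h | h
            · exact absurd (h3 e f1 (f4 ▸ h) e' f3 h) f2
            · rw [← f4, h, hb e e' f1 (f4.symm.trans h) f2 f3 h]; exact g2.symm
          · obtain ⟨s', g1, g2⟩ : ∃ s', Vd u lam x s' ∧ pos 1 s' ≠ a := by
              by_cases h : pos 1 s = a
              · exact ⟨s + 6, h2, by omega⟩
              · exact ⟨s, h1, h⟩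
            refine ⟨s', g1, ?_⟩
            intro e e' f1 f2 f3 f4
            rcases hy e' e f3 f4 f2 with h | h
            · rw [← f4, h, ha e e' f1 (f4.symm.trans h) f2 f3 h]; exact g2.symm
            · exact absurd (h3 e f1 (f4 ▸ h) e' f3 h) f2
        · refine absurd ?_ hxA
          rw [← hA]
          exact Finset.mem_union_left _ (Finset.mem_filter.2 ⟨Finset.mem_univ _, h⟩)
      refine ⟨Function.update S x s, ?_, ?_⟩
      · intro z hz
        by_cases hzx : z = x
        · subst hzx; simpa using hs
        · rw [Function.update_of_ne hzx]
          exact hS1 z (by simpa [hzx] using hz)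
      · intro e e' he he' hne hwe hl
        by_cases h1 : u e = x
        · have h2 : u e' ≠ x := fun h => hne (hinj _ _ (h1.trans h.symm) hl)
          rw [h1, Function.update_self, Function.update_of_ne h2, ← hl]
          exact (hs1 e e' h1 hne.symm hwe.symm hl.symm).symm
        · by_cases h2 : u e' = x
          · rw [h2, Function.update_self, Function.update_of_ne h1, hl]
            exact hs1 e' e h2 hne hwe hl
          · rw [Function.update_of_ne h1, Function.update_of_ne h2]
            exact hS2 e e' (by simpa [h1] using he) (by simpa [h2] using he') hne hwe hl
  obtain ⟨S, hS1', hS2'⟩ := main Finset.univ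
  have hS1 : ∀ x, Vd u lam x (S x) :=
    fun x => hS1' x (Finset.mem_union_right _ (Finset.mem_univ x))
  have hS2 : ∀ e e', e ≠ e' → w e = w e' → lam e = lam e' →
        pos (lam e) (S (u e)) ≠ pos (lam e') (S (u e')) :=
    fun e e' => hS2' e e' (Finset.mem_union_right _ (Finset.mem_univ _))
      (Finset.mem_union_right _ (Finset.mem_univ _))
  have hmod : ∀ e, pos (lam e) (S (u e)) % 6 = lam e := by
    intro e
    have := (hS1 (u e)).1
    rw [pos_mod (by omega), Nat.mod_eq_of_lt (hlt e)]
  refine ⟨fun e => pos (lam e) (S (u e)), ?_, ?_, ?_⟩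
  · intro e
    have h1 := (hS1 (u e)).1
    have h2 := (hS1 (u e)).2 e rfl
    simp only [pos]
    omega
  · intro e e' hne h heq
    have hl : lam e = lam e' := by
      rw [← hmod e, ← hmod e']; exact congrArg (· % 6) heq
    rcases h with h | h
    · exact hne (hinj _ _ h hl)
    · exact hS2 e e' hne h hl heq
  · intro e e' m h h1 h2
    have hcard : ((Finset.univ.filter (fun d => u d = u e)).image (fun d => pos (lam d) (S (u d))))
        = Finset.Ico (S (u e)) (S (u e) + fdeg u (u e)) := by
      apply Finset.eq_of_subset_of_card_le
      · intro n hn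
        simp only [Finset.mem_image, Finset.mem_filter, Finset.mem_univ, true_and] at hn
        obtain ⟨d, hd, rfl⟩ := hn
        have := (hS1 (u e)).2 d hd
        rw [hd]
        simp only [Finset.mem_Ico, pos]
        omega
      · rw [Finset.card_image_of_injOn]
        · simp [fdeg]
        · intro d hd d' hd' heq
          simp only [Finset.coe_filter, Finset.mem_univ, true_and, Set.mem_setOf_eq] at hd hd'
          have hl : lam d = lam d' := by
            rw [← hmod d, ← hmod d']; exact congrArg (· % 6) heq
          exact hinj _ _ (hd.trans hd'.symm) hl
    have hm : m ∈ Finset.Ico (S (u e)) (S (u e) + fdeg u (u e)) := by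
      have := (hS1 (u e)).2 e' h.symm
      simp only [pos, ← h] at h1 h2
      simp only [Finset.mem_Ico]
      omega
    rw [← hcard] at hm
    simpa using hm
theorem cnt_two {E V : Type*} [Fintype E] [DecidableEq V] (u : E → V) (M F : E → Bool) (x : V)
    (m f : Bool) (h : cnt u M F x m f ≤ 2) (a b c : E)
    (ha : u a = x ∧ M a = m ∧ F a = f) (hb : u b = x ∧ M b = m ∧ F b = f)
    (hc : u c = x ∧ M c = m ∧ F c = f) : a = b ∨ b = c ∨ a = c := by
  by_contra hcon
  push Not at hcon
  have : 2 < cnt u M F x m f := by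
    unfold cnt
    rw [Finset.two_lt_card]
    exact ⟨a, by simpa using ha, b, by simpa using hb, c, by simpa using hc, hcon.1, hcon.2.2,
      hcon.2.1⟩
  omega

theorem cnt_one {E V : Type*} [Fintype E] [DecidableEq V] (u : E → V) (M F : E → Bool) (x : V)
    (m f : Bool) (h : cnt u M F x m f ≤ 1) (a b : E)
    (ha : u a = x ∧ M a = m ∧ F a = f) (hb : u b = x ∧ M b = m ∧ F b = f) : a = b := by
  unfold cnt at h
  exact Finset.card_le_one.1 h a (by simpa using ha) b (by simpa using hb)

theorem cnt_zero {E V : Type*} [Fintype E] [DecidableEq V] (u : E → V) (M F : E → Bool) (x : V)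
    (m f : Bool) (h : cnt u M F x m f = 0) (a : E)
    (ha : u a = x) (hM : M a = m) (hF : F a = f) : False := by
  unfold cnt at h
  rw [Finset.card_eq_zero] at h
  have : a ∈ Finset.univ.filter (fun e => u e = x ∧ M e = m ∧ F e = f) := by
    simp [ha, hM, hF]
  rw [h] at this
  simp at this

theorem cnt_pos {E V : Type*} [Fintype E] [DecidableEq V] (u : E → V) (M F : E → Bool) (x : V)
    (m f : Bool) (h : 1 ≤ cnt u M F x m f) : ∃ a, u a = x ∧ M a = m ∧ F a = f := by
  unfold cnt at h
  obtain ⟨a, ha⟩ := Finset.card_pos.1 h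
  exact ⟨a, by simpa using ha⟩

/-- label from the three bits -/
def lb (m f g : Bool) : ℕ :=
  if m then (if f then 4 else 1) else
    (if f then (if g then 5 else 3) else (if g then 2 else 0))

theorem lb_inj_MF {m f g m' f' g' : Bool} (h : lb m f g = lb m' f' g') :
    m = m' ∧ f = f' ∧ (m = false → g = g') := by
  revert m f g m' f' g'; decide

theorem lb_14 {m f g : Bool} (h : m = true) : lb m f g = 1 ∨ lb m f g = 4 := by
  revert m f g; decide

theorem lb_1 {m f g : Bool} (h : lb m f g = 1) : m = true ∧ f = false := by
  revert m f g; decide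

theorem lb_4 {m f g : Bool} (h : lb m f g = 4) : m = true ∧ f = true := by
  revert m f g; decide

set_option maxHeartbeats 1000000 in
theorem core {E V W : Type*} [Fintype E] [DecidableEq E] [DecidableEq V]
    [DecidableEq W] [Fintype V]
    (u : E → V) (w : E → W) (hu3 : ∀ x, 3 ≤ fdeg u x) (hu : ∀ x, fdeg u x ≤ 6)
    (hw : ∀ y, fdeg w y ≤ 6) :
    ∃ c : E → ℕ, (∀ e, c e < 17) ∧ (∀ e e', e ≠ e' → (u e = u e' ∨ w e = w e') → c e ≠ c e') ∧
      (∀ e e' m, u e = u e' → c e ≤ m → m ≤ c e' → ∃ d, u d = u e ∧ c d = m) := by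
  obtain ⟨M0, F, h0⟩ := St_exists u w hu3 hu hw
  obtain ⟨M, ⟨hX, hY⟩, hmin⟩ := St_min u w F _ M0 rfl h0
  have hMu : ∀ x f, cnt u M F x true f ≤ 1 := by
    intro x f
    cases f <;> rcases hX x with h | h | h | h | h | h | h <;> omega
  have hNu : ∀ x f, cnt u M F x false f ≤ 2 := by
    intro x f
    cases f <;> rcases hX x with h | h | h | h | h | h | h <;> omega
  have hNu1 : ∀ x f, ¬ 5 ≤ fdeg u x → cnt u M F x false f ≤ 1 := by
    intro x f hx
    cases f <;> rcases hX x with h | h | h | h | h | h | h <;> omega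
  have hw2 : ∀ y m f, cnt w M F y m f ≤ 2 := by
    intro y m f
    have := hY y
    cases f <;> cases m <;> omega
  obtain ⟨g, hg⟩ := two_color (Finset.univ.filter (fun e => M e = false))
    (fun e => (u e, if 5 ≤ fdeg u (u e) then F e else false)) (fun e => (w e, F e))
    (by
      intro a ha b hb c hc hab hbc
      simp only [Finset.mem_filter, Finset.mem_univ, true_and, Prod.mk.injEq] at ha hb hc hab hbc
      obtain ⟨hab1, hab2⟩ := hab
      obtain ⟨hbc1, hbc2⟩ := hbc
      by_cases h5 : 5 ≤ fdeg u (u b)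
      · simp only [hab1, ← hbc1, h5, if_true] at hab2 hbc2
        exact cnt_two u M F (u b) false (F b) (hNu _ _) a b c ⟨hab1, ha, hab2⟩ ⟨rfl, hb, rfl⟩
          ⟨hbc1.symm, hc, hbc2.symm⟩
      · have k := fun f => cnt_one u M F (u b) false f (hNu1 _ _ h5)
        by_cases h1 : F a = F b
        · left; exact k (F b) a b ⟨hab1, ha, h1⟩ ⟨rfl, hb, rfl⟩
        · by_cases h2 : F b = F c
          · right; left; exact k (F b) b c ⟨rfl, hb, rfl⟩ ⟨hbc1.symm, hc, h2.symm⟩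
          · right; right
            refine k (F c) a c ⟨hab1, ha, ?_⟩ ⟨hbc1.symm, hc, rfl⟩
            cases h3 : F a <;> cases h4 : F b <;> cases h5 : F c <;> simp_all)
    (by
      intro a ha b hb c hc hab hbc
      simp only [Finset.mem_filter, Finset.mem_univ, true_and, Prod.mk.injEq] at ha hb hc hab hbc
      exact cnt_two w M F (w b) false (F b) (hw2 _ _ _) a b c ⟨hab.1, ha, hab.2⟩ ⟨rfl, hb, rfl⟩
          ⟨hbc.1.symm, hc, hbc.2.symm⟩)
  simp only [Finset.mem_filter, Finset.mem_univ, true_and, Prod.mk.injEq] at hg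
  have hlow : ∀ x, ¬ 5 ≤ fdeg u x → ∀ a b, u a = x → u b = x → M a = false → M b = false →
      F a = false → F b = true → g a ≠ g b := by
    intro x hx a b ha hb hMa hMb hFa hFb
    refine hg a hMa b hMb (fun h => by simp [h, hFb] at hFa) (Or.inl ⟨ha.trans hb.symm, ?_⟩)
    simp [ha, hb, hx]
  have hal1 : ∀ x, cnt u M F x true false = 0 →
      Alone u w (fun e => lb (M e) (F e) (g e)) 1 x := by
    intro x hx e he hl
    exact (cnt_zero u M F x true false hx e he (lb_1 hl).1 (lb_1 hl).2).elim
  have hal4 : ∀ x, cnt u M F x true true = 0 →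
      Alone u w (fun e => lb (M e) (F e) (g e)) 4 x := by
    intro x hx e he hl
    exact (cnt_zero u M F x true true hx e he (lb_4 hl).1 (lb_4 hl).2).elim
  refine lift u w (fun e => lb (M e) (F e) (g e)) ?_ ?_ ?_ ?_ ?_
  · intro e
    generalize M e = m; generalize F e = f; generalize g e = k
    revert m f k; decide
  · intro e e' hue hl
    obtain ⟨h1, h2, h3⟩ := lb_inj_MF hl
    cases hm : M e
    · by_contra hne
      refine hg e hm e' (h1 ▸ hm) hne (Or.inl ⟨hue, ?_⟩) (h3 hm)
      rw [hue, h2]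
    · exact cnt_one u M F (u e') true (F e') (hMu _ _) e e' ⟨hue, hm, h2⟩ ⟨rfl, h1 ▸ hm, rfl⟩
  · intro e e' hwe hl hne
    obtain ⟨h1, h2, h3⟩ := lb_inj_MF hl
    cases hm : M e
    · exact absurd (h3 hm) (hg e hm e' (h1 ▸ hm) hne (Or.inr ⟨hwe, h2⟩))
    · exact lb_14 rfl
  · intro a b c hab hbc hl hl'
    obtain ⟨h1, h2, h3⟩ := lb_inj_MF hl
    obtain ⟨h1', h2', h3'⟩ := lb_inj_MF hl'
    exact cnt_two w M F (w b) (M b) (F b) (hw2 _ _ _) a b c ⟨hab, h1, h2⟩ ⟨rfl, rfl, rfl⟩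
      ⟨hbc.symm, h1'.symm, h2'.symm⟩
  · intro x
    rcases hX x with h | h | h | h | h | h | h
    · -- degree 6
      left
      intro a b
      have hv : ∀ S, S ≤ 11 → Vd u (fun e => lb (M e) (F e) (g e)) x S := by
        intro S hS
        refine ⟨by omega, fun e _ => ?_⟩
        rw [h.1]; exact Nat.mod_lt _ (by norm_num)
      have p1 : pos 1 0 = 1 ∧ pos 4 0 = 4 ∧ pos 1 11 = 13 ∧ pos 4 11 = 16 ∧ pos 1 2 = 7 ∧
        pos 4 2 = 4 ∧ pos 1 5 = 7 ∧ pos 4 5 = 10 := by decide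
      by_cases c0 : pos 1 0 ≠ a ∧ pos 4 0 ≠ b
      · exact ⟨0, hv _ (by norm_num), c0⟩
      by_cases c1 : pos 1 11 ≠ a ∧ pos 4 11 ≠ b
      · exact ⟨11, hv _ (by norm_num), c1⟩
      by_cases c2 : pos 1 2 ≠ a ∧ pos 4 2 ≠ b
      · exact ⟨2, hv _ (by norm_num), c2⟩
      refine ⟨5, hv _ (by norm_num), ?_⟩
      omega
    · -- degree 5, two in F0
      obtain ⟨n, hn, hnM, hnF⟩ := cnt_pos u M F x false true (by omega)
      have hun : ∀ e, u e = x → M e = false → F e = true → g e = g n := by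
        intro e h1 h2 h3
        rw [cnt_one u M F x false true (by omega) e n ⟨h1, h2, h3⟩ ⟨hn, hnM, hnF⟩]
      cases hgn : g n
      · left
        intro a b
        have hv : ∀ S, S = 0 ∨ S = 6 ∨ S = 12 → Vd u (fun e => lb (M e) (F e) (g e)) x S := by
          intro S hS
          refine ⟨by omega, fun e he => ?_⟩
          have := hun e he
          rw [h.1]; rw [hgn] at this
          show (lb (M e) (F e) (g e) + 18 - S) % 6 < _
          revert this
          generalize M e = m; generalize F e = f; generalize g e = k
          revert m f k
          rcases hS with rfl | rfl | rfl <;> decide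
        have p1 : pos 1 0 = 1 ∧ pos 4 0 = 4 ∧ pos 1 6 = 7 ∧ pos 4 6 = 10 ∧ pos 1 12 = 13 ∧
          pos 4 12 = 16 := by decide
        by_cases c0 : pos 1 0 ≠ a ∧ pos 4 0 ≠ b
        · exact ⟨0, hv _ (by norm_num), c0⟩
        by_cases c1 : pos 1 6 ≠ a ∧ pos 4 6 ≠ b
        · exact ⟨6, hv _ (by norm_num), c1⟩
        refine ⟨12, hv _ (by norm_num), ?_⟩
        omega
      · right; right
        have hv : ∀ S, S = 4 ∨ S = 10 → Vd u (fun e => lb (M e) (F e) (g e)) x S := by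
          intro S hS
          refine ⟨by omega, fun e he => ?_⟩
          have := hun e he
          rw [h.1]; rw [hgn] at this
          show (lb (M e) (F e) (g e) + 18 - S) % 6 < _
          revert this
          generalize M e = m; generalize F e = f; generalize g e = k
          revert m f k
          rcases hS with rfl | rfl <;> decide
        exact ⟨4, by norm_num, hv _ (by norm_num), hv _ (by norm_num)⟩
    · -- degree 5, one in F0
      obtain ⟨n, hn, hnM, hnF⟩ := cnt_pos u M F x false false (by omega)
      have hun : ∀ e, u e = x → M e = false → F e = false → g e = g n := by
        intro e h1 h2 h3
        rw [cnt_one u M F x false false (by omega) e n ⟨h1, h2, h3⟩ ⟨hn, hnM, hnF⟩]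
      cases hgn : g n
      · right; right
        have hv : ∀ S, S = 3 ∨ S = 9 → Vd u (fun e => lb (M e) (F e) (g e)) x S := by
          intro S hS
          refine ⟨by omega, fun e he => ?_⟩
          have := hun e he
          rw [h.1]; rw [hgn] at this
          show (lb (M e) (F e) (g e) + 18 - S) % 6 < _
          revert this
          generalize M e = m; generalize F e = f; generalize g e = k
          revert m f k
          rcases hS with rfl | rfl <;> decide
        exact ⟨3, by norm_num, hv _ (by norm_num), hv _ (by norm_num)⟩
      · right; left
        have hv : ∀ S, S = 1 ∨ S = 7 → Vd u (fun e => lb (M e) (F e) (g e)) x S := by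
          intro S hS
          refine ⟨by omega, fun e he => ?_⟩
          have := hun e he
          rw [h.1]; rw [hgn] at this
          show (lb (M e) (F e) (g e) + 18 - S) % 6 < _
          revert this
          generalize M e = m; generalize F e = f; generalize g e = k
          revert m f k
          rcases hS with rfl | rfl <;> decide
        refine ⟨1, hv _ (by norm_num), hv _ (by norm_num), Or.inl ?_⟩
        intro e he hl e' he' hl'
        refine cnt_one w M F (w e) true false ?_ e' e ⟨he', lb_1 hl'⟩ ⟨rfl, lb_1 hl⟩
        exact hmin e (lb_1 hl).1 (lb_1 hl).2 (by rw [he]; exact h.1) (by rw [he]; omega)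
    · -- degree 5, dropped
      right; left
      have hz := cnt_zero u M F x true false h.2.1
      have hv : ∀ S, S = 2 ∨ S = 8 → Vd u (fun e => lb (M e) (F e) (g e)) x S := by
        intro S hS
        refine ⟨by omega, fun e he => ?_⟩
        have := hz e he
        rw [h.1]
        show (lb (M e) (F e) (g e) + 18 - S) % 6 < _
        revert this
        generalize M e = m; generalize F e = f; generalize g e = k
        revert m f k
        rcases hS with rfl | rfl <;> decide
      exact ⟨2, hv _ (by norm_num), hv _ (by norm_num), Or.inl (hal1 x h.2.1)⟩
    · -- degree 4
      obtain ⟨n, hn, hnM, hnF⟩ := cnt_pos u M F x false false (by omega)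
      obtain ⟨n', hn', hnM', hnF'⟩ := cnt_pos u M F x false true (by omega)
      have hun : ∀ e, u e = x → M e = false → F e = false → g e = g n := by
        intro e h1 h2 h3
        rw [cnt_one u M F x false false (by omega) e n ⟨h1, h2, h3⟩ ⟨hn, hnM, hnF⟩]
      have hun' : ∀ e, u e = x → M e = false → F e = true → g e = g n' := by
        intro e h1 h2 h3
        rw [cnt_one u M F x false true (by omega) e n' ⟨h1, h2, h3⟩ ⟨hn', hnM', hnF'⟩]
      have hgg := hlow x (by omega) n n' hn hn' hnM hnM' hnF hnF'
      cases hgn : g n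
      · have hgn' : g n' = true := by
          cases h' : g n' <;> simp_all
        right; right
        have hv : ∀ S, S = 4 ∨ S = 10 → Vd u (fun e => lb (M e) (F e) (g e)) x S := by
          intro S hS
          refine ⟨by omega, fun e he => ?_⟩
          have t1 := hun e he
          have t2 := hun' e he
          rw [h.1]; rw [hgn] at t1; rw [hgn'] at t2
          show (lb (M e) (F e) (g e) + 18 - S) % 6 < _
          revert t1 t2
          generalize M e = m; generalize F e = f; generalize g e = k
          revert m f k
          rcases hS with rfl | rfl <;> decide
        exact ⟨4, by norm_num, hv _ (by norm_num), hv _ (by norm_num)⟩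
      · have hgn' : g n' = false := by
          cases h' : g n' <;> simp_all
        left
        intro a b
        have hv : ∀ S, S = 1 ∨ S = 7 ∨ S = 13 → Vd u (fun e => lb (M e) (F e) (g e)) x S := by
          intro S hS
          refine ⟨by omega, fun e he => ?_⟩
          have t1 := hun e he
          have t2 := hun' e he
          rw [h.1]; rw [hgn] at t1; rw [hgn'] at t2
          show (lb (M e) (F e) (g e) + 18 - S) % 6 < _
          revert t1 t2
          generalize M e = m; generalize F e = f; generalize g e = k
          revert m f k
          rcases hS with rfl | rfl | rfl <;> decide
        have p1 : pos 1 1 = 1 ∧ pos 4 1 = 4 ∧ pos 1 7 = 7 ∧ pos 4 7 = 10 ∧ pos 1 13 = 13 ∧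
          pos 4 13 = 16 := by decide
        by_cases c0 : pos 1 1 ≠ a ∧ pos 4 1 ≠ b
        · exact ⟨1, hv _ (by norm_num), c0⟩
        by_cases c1 : pos 1 7 ≠ a ∧ pos 4 7 ≠ b
        · exact ⟨7, hv _ (by norm_num), c1⟩
        refine ⟨13, hv _ (by norm_num), ?_⟩
        omega
    · -- degree 3, M in F0
      right; left
      obtain ⟨n, hn, hnM, hnF⟩ := cnt_pos u M F x false false (by omega)
      obtain ⟨n', hn', hnM', hnF'⟩ := cnt_pos u M F x false true (by omega)
      have hun : ∀ e, u e = x → M e = false → F e = false → g e = g n := by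
        intro e h1 h2 h3
        rw [cnt_one u M F x false false (by omega) e n ⟨h1, h2, h3⟩ ⟨hn, hnM, hnF⟩]
      have hun' : ∀ e, u e = x → M e = false → F e = true → g e = g n' := by
        intro e h1 h2 h3
        rw [cnt_one u M F x false true (by omega) e n' ⟨h1, h2, h3⟩ ⟨hn', hnM', hnF'⟩]
      have hgg := hlow x (by omega) n n' hn hn' hnM hnM' hnF hnF'
      have hz := cnt_zero u M F x true true h.2.2.1
      cases hgn : g n
      · have hgn' : g n' = true := by
          cases h' : g n' <;> simp_all
        have hv : ∀ S, S = 5 ∨ S = 11 → Vd u (fun e => lb (M e) (F e) (g e)) x S := by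
          intro S hS
          refine ⟨by omega, fun e he => ?_⟩
          have t1 := hun e he
          have t2 := hun' e he
          have t3 := hz e he
          rw [h.1]; rw [hgn] at t1; rw [hgn'] at t2
          show (lb (M e) (F e) (g e) + 18 - S) % 6 < _
          revert t1 t2 t3
          generalize M e = m; generalize F e = f; generalize g e = k
          revert m f k
          rcases hS with rfl | rfl <;> decide
        exact ⟨5, hv _ (by norm_num), hv _ (by norm_num), Or.inr (hal4 x h.2.2.1)⟩
      · have hgn' : g n' = false := by
          cases h' : g n' <;> simp_all
        have hv : ∀ S, S = 1 ∨ S = 7 → Vd u (fun e => lb (M e) (F e) (g e)) x S := by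
          intro S hS
          refine ⟨by omega, fun e he => ?_⟩
          have t1 := hun e he
          have t2 := hun' e he
          have t3 := hz e he
          rw [h.1]; rw [hgn] at t1; rw [hgn'] at t2
          show (lb (M e) (F e) (g e) + 18 - S) % 6 < _
          revert t1 t2 t3
          generalize M e = m; generalize F e = f; generalize g e = k
          revert m f k
          rcases hS with rfl | rfl <;> decide
        exact ⟨1, hv _ (by norm_num), hv _ (by norm_num), Or.inr (hal4 x h.2.2.1)⟩
    · -- degree 3, M in F1
      right; left
      obtain ⟨n, hn, hnM, hnF⟩ := cnt_pos u M F x false false (by omega)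
      obtain ⟨n', hn', hnM', hnF'⟩ := cnt_pos u M F x false true (by omega)
      have hun : ∀ e, u e = x → M e = false → F e = false → g e = g n := by
        intro e h1 h2 h3
        rw [cnt_one u M F x false false (by omega) e n ⟨h1, h2, h3⟩ ⟨hn, hnM, hnF⟩]
      have hun' : ∀ e, u e = x → M e = false → F e = true → g e = g n' := by
        intro e h1 h2 h3
        rw [cnt_one u M F x false true (by omega) e n' ⟨h1, h2, h3⟩ ⟨hn', hnM', hnF'⟩]
      have hgg := hlow x (by omega) n n' hn hn' hnM hnM' hnF hnF'
      have hz := cnt_zero u M F x true false h.2.1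
      cases hgn : g n
      · have hgn' : g n' = true := by
          cases h' : g n' <;> simp_all
        have hv : ∀ S, S = 4 ∨ S = 10 → Vd u (fun e => lb (M e) (F e) (g e)) x S := by
          intro S hS
          refine ⟨by omega, fun e he => ?_⟩
          have t1 := hun e he
          have t2 := hun' e he
          have t3 := hz e he
          rw [h.1]; rw [hgn] at t1; rw [hgn'] at t2
          show (lb (M e) (F e) (g e) + 18 - S) % 6 < _
          revert t1 t2 t3
          generalize M e = m; generalize F e = f; generalize g e = k
          revert m f k
          rcases hS with rfl | rfl <;> decide
        exact ⟨4, hv _ (by norm_num), hv _ (by norm_num), Or.inl (hal1 x h.2.1)⟩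
      · have hgn' : g n' = false := by
          cases h' : g n' <;> simp_all
        have hv : ∀ S, S = 2 ∨ S = 8 → Vd u (fun e => lb (M e) (F e) (g e)) x S := by
          intro S hS
          refine ⟨by omega, fun e he => ?_⟩
          have t1 := hun e he
          have t2 := hun' e he
          have t3 := hz e he
          rw [h.1]; rw [hgn] at t1; rw [hgn'] at t2
          show (lb (M e) (F e) (g e) + 18 - S) % 6 < _
          revert t1 t2 t3
          generalize M e = m; generalize F e = f; generalize g e = k
          revert m f k
          rcases hS with rfl | rfl <;> decide
        exact ⟨2, hv _ (by norm_num), hv _ (by norm_num), Or.inl (hal1 x h.2.1)⟩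
theorem base_sub {E V W : Type*} [Fintype E] [DecidableEq E] [DecidableEq V]
    [DecidableEq W] [Fintype V]
    (u : E → V) (w : E → W) (hu : ∀ x, fdeg u x ≤ 6) (hw : ∀ y, fdeg w y ≤ 6) :
    ∃ c : E → ℕ, (∀ e, 3 ≤ fdeg u (u e) → c e < 17) ∧
      (∀ e e', 3 ≤ fdeg u (u e) → 3 ≤ fdeg u (u e') → e ≠ e' → (u e = u e' ∨ w e = w e') →
        c e ≠ c e') ∧
      (∀ e e' m, 3 ≤ fdeg u (u e) → u e = u e' → c e ≤ m → m ≤ c e' → ∃ d, u d = u e ∧ c d = m) := by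
  classical
  let u3 : {e // 3 ≤ fdeg u (u e)} → {x // 3 ≤ fdeg u x} := fun e => ⟨u e.1, e.2⟩
  let w3 : {e // 3 ≤ fdeg u (u e)} → W := fun e => w e.1
  have hdeg : ∀ x, fdeg u3 x = fdeg u x.1 := by
    intro x
    unfold fdeg
    refine Finset.card_bij (fun e _ => e.1) ?_ ?_ ?_
    · intro e he
      simp only [Finset.mem_filter, Finset.mem_univ, true_and] at he ⊢
      exact congrArg Subtype.val he
    · intro a _ b _ h
      exact Subtype.ext h
    · intro b hb
      simp only [Finset.mem_filter, Finset.mem_univ, true_and] at hb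
      refine ⟨⟨b, by rw [hb]; exact x.2⟩, ?_, rfl⟩
      simp only [Finset.mem_filter, Finset.mem_univ, true_and]
      exact Subtype.ext hb
  have hwd : ∀ y, fdeg w3 y ≤ fdeg w y := by
    intro y
    unfold fdeg
    refine Finset.card_le_card_of_injOn (fun e => e.1) ?_ ?_
    · intro e he
      simpa [w3] using he
    · intro a _ b _ h
      exact Subtype.ext h
  obtain ⟨c, h1, h2, h3⟩ := core u3 w3 (fun x => by rw [hdeg]; exact x.2)
    (fun x => by rw [hdeg]; exact hu _) (fun y => (hwd y).trans (hw y))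
  refine ⟨fun e => if h : 3 ≤ fdeg u (u e) then c ⟨e, h⟩ else 0, ?_, ?_, ?_⟩
  · intro e he
    simp only [dif_pos he]
    exact h1 _
  · intro e e' he he' hne h
    simp only [dif_pos he, dif_pos he']
    refine h2 _ _ (fun h => hne (congrArg Subtype.val h)) ?_
    rcases h with h | h
    · left; exact Subtype.ext h
    · right; exact h
  · intro e e' m he hue hm hm'
    have he' : 3 ≤ fdeg u (u e') := hue ▸ he
    simp only [dif_pos he, dif_pos he'] at hm hm'
    obtain ⟨d, hd, hd'⟩ := h3 ⟨e, he⟩ ⟨e', he'⟩ m (Subtype.ext hue) hm hm'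
    refine ⟨d.1, congrArg Subtype.val hd, ?_⟩
    simp only [dif_pos d.2]
    exact hd'

theorem small_step {E V W : Type*} [Fintype E] [DecidableEq E] [DecidableEq V]
    [DecidableEq W] (u : E → V) (w : E → W) (hw : ∀ y, fdeg w y ≤ 6) (x : V)
    (hx : fdeg u x ≤ 2) (c : E → ℕ) :
    ∃ d : E → ℕ, (∀ e, u e = x → d e < 17) ∧
      (∀ e e', u e = x → u e' ≠ x → w e' = w e → c e' ≠ d e) ∧
      (∀ e e', u e = x → u e' = x → e ≠ e' → d e ≠ d e') ∧
      (∀ e e' m, u e = x → u e' = x → d e ≤ m → m ≤ d e' → ∃ f, u f = x ∧ d f = m) := by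
  let B : E → Finset ℕ := fun e => ((Finset.univ.filter (fun e' => w e' = w e)).erase e).image c
  have hB : ∀ e, (B e).card ≤ 5 := by
    intro e
    refine Finset.card_image_le.trans ?_
    rw [Finset.card_erase_of_mem (by simp)]
    have := hw (w e)
    unfold fdeg at this
    omega
  have hBm : ∀ e e', e' ≠ e → w e' = w e → c e' ∈ B e := by
    intro e e' h1 h2
    exact Finset.mem_image_of_mem c (by simp [h1, h2])
  have hT : ∀ e, u e = x ↔ e ∈ Finset.univ.filter (fun e => u e = x) := by simp
  unfold fdeg at hx
  generalize Finset.univ.filter (fun e => u e = x) = T at hx hT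
  have hcases : T.card = 0 ∨ T.card = 1 ∨ T.card = 2 := by omega
  rcases hcases with h | h | h
  · rw [Finset.card_eq_zero] at h
    subst h
    exact ⟨fun _ => 0, by simp [hT], by simp [hT], by simp [hT], by simp [hT]⟩
  · rw [Finset.card_eq_one] at h
    obtain ⟨e1, rfl⟩ := h
    simp only [Finset.mem_singleton] at hT
    obtain ⟨a, ha⟩ : (Finset.range 17 \ B e1).Nonempty := by
      rw [← Finset.card_pos]
      have h1 := Finset.le_card_sdiff (B e1) (Finset.range 17)
      have h2 := hB e1
      rw [Finset.card_range] at h1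
      omega
    simp only [Finset.mem_sdiff, Finset.mem_range] at ha
    refine ⟨fun _ => a, fun _ _ => ha.1, ?_, ?_, ?_⟩
    · intro e e' h1 h2 h3 h4
      have h1' := (hT e).1 h1
      subst h1'
      dsimp only at h4
      refine ha.2 (h4 ▸ hBm _ _ ?_ h3)
      rintro rfl; exact h2 h1
    · intro e e' h1 h2 h3
      exact absurd (((hT e).1 h1).trans ((hT e').1 h2).symm) h3
    · intro e e' m h1 h2 h3 h4
      exact ⟨e, h1, le_antisymm h3 h4⟩
  · rw [Finset.card_eq_two] at h
    obtain ⟨e1, e2, hne, rfl⟩ := h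
    simp only [Finset.mem_insert, Finset.mem_singleton] at hT
    obtain ⟨a, ha⟩ : (Finset.range 16 \ (B e1 ∪ (B e2).image (fun n => n - 1))).Nonempty := by
      rw [← Finset.card_pos]
      have h1 := Finset.le_card_sdiff (B e1 ∪ (B e2).image (fun n => n - 1)) (Finset.range 16)
      have h2 := Finset.card_union_le (B e1) ((B e2).image (fun n => n - 1))
      have h3 : ((B e2).image (fun n => n - 1)).card ≤ (B e2).card := Finset.card_image_le
      have h4 := hB e1
      have h5 := hB e2
      rw [Finset.card_range] at h1
      omega
    simp only [Finset.mem_sdiff, Finset.mem_range, Finset.mem_union, not_or] at ha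
    obtain ⟨ha1, ha2, ha3⟩ := ha
    have ha4 : a + 1 ∉ B e2 := fun h => ha3 (Finset.mem_image.2 ⟨a + 1, h, by simp⟩)
    have d1 : (if e1 = e1 then a else a + 1) = a := if_pos rfl
    have d2 : (if e2 = e1 then a else a + 1) = a + 1 := if_neg hne.symm
    refine ⟨fun e => if e = e1 then a else a + 1, ?_, ?_, ?_, ?_⟩
    · intro e _
      dsimp only
      split_ifs <;> omega
    · intro e e' h1 h2 h3 h4
      have hee : e' ≠ e := by rintro rfl; exact h2 h1
      rcases (hT e).1 h1 with rfl | rfl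
      · simp only [if_true] at h4
        exact ha2 (h4 ▸ hBm _ _ hee h3)
      · simp only [if_neg hne.symm] at h4
        exact ha4 (h4 ▸ hBm _ _ hee h3)
    · intro e e' h1 h2 h3
      rcases (hT e).1 h1 with rfl | rfl <;> rcases (hT e').1 h2 with rfl | rfl
      · exact absurd rfl h3
      · simp [hne.symm]
      · simp [hne.symm]
      · exact absurd rfl h3
    · intro e e' m h1 h2 h3 h4
      have hm : m = a ∨ m = a + 1 := by
        dsimp only at h3 h4
        split_ifs at h3 h4 <;> omega
      rcases hm with rfl | rfl
      · exact ⟨e1, (hT e1).2 (Or.inl rfl), d1⟩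
      · exact ⟨e2, (hT e2).2 (Or.inr rfl), d2⟩

theorem all_deg {E V W : Type*} [Fintype E] [DecidableEq E] [DecidableEq V]
    [DecidableEq W] [Fintype V]
    (u : E → V) (w : E → W) (hu : ∀ x, fdeg u x ≤ 6) (hw : ∀ y, fdeg w y ≤ 6) :
    ∃ c : E → ℕ, (∀ e, c e < 17) ∧ (∀ e e', e ≠ e' → (u e = u e' ∨ w e = w e') → c e ≠ c e') ∧
      (∀ e e' m, u e = u e' → c e ≤ m → m ≤ c e' → ∃ d, u d = u e ∧ c d = m) := by
  have main : ∀ T : Finset V, ∃ c : E → ℕ,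
      (∀ e, (3 ≤ fdeg u (u e) ∨ u e ∈ T) → c e < 17) ∧
      (∀ e e', (3 ≤ fdeg u (u e) ∨ u e ∈ T) → (3 ≤ fdeg u (u e') ∨ u e' ∈ T) → e ≠ e' →
        (u e = u e' ∨ w e = w e') → c e ≠ c e') ∧
      (∀ e e' m, (3 ≤ fdeg u (u e) ∨ u e ∈ T) → u e = u e' → c e ≤ m → m ≤ c e' →
        ∃ d, u d = u e ∧ c d = m) := by
    intro T
    induction T using Finset.induction_on with
    | empty => simpa using base_sub u w hu hw
    | insert x T hx ih =>
      obtain ⟨c, h1, h2, h3⟩ := ih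
      by_cases hx3 : 3 ≤ fdeg u x
      · have : ∀ e, (3 ≤ fdeg u (u e) ∨ u e ∈ insert x T) → (3 ≤ fdeg u (u e) ∨ u e ∈ T) := by
          intro e he
          rcases he with he | he
          · exact Or.inl he
          · rcases Finset.mem_insert.1 he with he | he
            · left; rw [he]; exact hx3
            · exact Or.inr he
        exact ⟨c, fun e he => h1 e (this e he), fun e e' he he' => h2 e e' (this e he) (this e' he'),
          fun e e' m he => h3 e e' m (this e he)⟩
      · obtain ⟨d, g1, g2, g3, g4⟩ := small_step u w hw x (by omega) c
        have key : ∀ e, u e ≠ x → (3 ≤ fdeg u (u e) ∨ u e ∈ insert x T) →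
            (3 ≤ fdeg u (u e) ∨ u e ∈ T) := by
          intro e hne he
          rcases he with he | he
          · exact Or.inl he
          · exact Or.inr (Finset.mem_of_mem_insert_of_ne he hne)
        refine ⟨fun e => if u e = x then d e else c e, ?_, ?_, ?_⟩
        · intro e he
          dsimp only
          split_ifs with h
          · exact g1 e h
          · exact h1 e (key e h he)
        · intro e e' he he' hne hh
          dsimp only
          split_ifs with h h' h'
          · exact g3 e e' h h' hne
          · rcases hh with hh | hh
            · exact absurd (hh ▸ h) h'
            · exact (g2 e e' h h' hh.symm).symm
          · rcases hh with hh | hh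
            · exact absurd (hh.trans h') h
            · exact g2 e' e h' h hh
          · exact h2 e e' (key e h he) (key e' h' he') hne hh
        · intro e e' m he hue hm hm'
          dsimp only at hm hm' ⊢
          by_cases h : u e = x
          · have h' : u e' = x := hue ▸ h
            rw [if_pos h] at hm
            rw [if_pos h'] at hm'
            obtain ⟨f, hf, hf'⟩ := g4 e e' m h h' hm hm'
            exact ⟨f, hf.trans h.symm, by rw [if_pos hf]; exact hf'⟩
          · have h' : u e' ≠ x := hue ▸ h
            rw [if_neg h] at hm
            rw [if_neg h'] at hm'
            obtain ⟨f, hf, hf'⟩ := h3 e e' m (key e h he) hue hm hm'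
            exact ⟨f, hf, by rw [if_neg (hf ▸ h)]; exact hf'⟩
  obtain ⟨c, h1, h2, h3⟩ := main Finset.univ
  have hm : ∀ e, (3 ≤ fdeg u (u e) ∨ u e ∈ Finset.univ) := fun e => Or.inr (Finset.mem_univ _)
  exact ⟨c, fun e => h1 e (hm e), fun e e' => h2 e e' (hm e) (hm e'),
    fun e e' m => h3 e e' m (hm e)⟩

/-- If `G = (X, Y; E)` is a bipartite graph with `Δ(G) = 6`, then `χ'_int(G, X) ≤ 17`:
`G` has an `X`-interval coloring using at most `17` colors. -/
theorem X_interval_coloring_seventeen_colors {V : Type*} [Fintype V] [DecidableEq V]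
    (G : SimpleGraph V) [DecidableRel G.Adj] (X : Set V)
    (hbip : IsBipartition G X)
    (hΔ : G.maxDegree = 6) :
    ∃ c : G.edgeSet → ℕ, IsProperEdgeColoring G c ∧ (∀ e, c e < 17) ∧
      ∀ x ∈ X, IntervalAt G c x := by
  classical
  have hdu : ∀ x, fdeg (fun p : {p : V × V // p.1 ∈ X ∧ G.Adj p.1 p.2} => p.1.1) x ≤ 6 := by
    intro x
    rw [← hΔ]
    refine le_trans ?_ (G.degree_le_maxDegree x)
    unfold fdeg
    rw [← G.card_neighborFinset_eq_degree]
    refine Finset.card_le_card_of_injOn (fun p => p.1.2) ?_ ?_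
    · intro p hp
      have hp' : p.1.1 = x := by simpa using hp
      have := p.2.2
      rw [hp'] at this
      simpa using this
    · intro p hp q hq h
      have hp' : p.1.1 = x := by simpa using hp
      have hq' : q.1.1 = x := by simpa using hq
      exact Subtype.ext (Prod.ext (hp'.trans hq'.symm) h)
  have hdw : ∀ y, fdeg (fun p : {p : V × V // p.1 ∈ X ∧ G.Adj p.1 p.2} => p.1.2) y ≤ 6 := by
    intro x
    rw [← hΔ]
    refine le_trans ?_ (G.degree_le_maxDegree x)
    unfold fdeg
    rw [← G.card_neighborFinset_eq_degree]
    refine Finset.card_le_card_of_injOn (fun p => p.1.1) ?_ ?_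
    · intro p hp
      have hp' : p.1.2 = x := by simpa using hp
      have := p.2.2.symm
      rw [hp'] at this
      simpa using this
    · intro p hp q hq h
      have hp' : p.1.2 = x := by simpa using hp
      have hq' : q.1.2 = x := by simpa using hq
      exact Subtype.ext (Prod.ext h (hp'.trans hq'.symm))
  obtain ⟨c, h1, h2, h3⟩ := all_deg _ _ hdu hdw
  have hex : ∀ e : G.edgeSet, ∃ p : {p : V × V // p.1 ∈ X ∧ G.Adj p.1 p.2},
      (e : Sym2 V) = s(p.1.1, p.1.2) := by
    rintro ⟨e, he⟩
    induction e using Sym2.ind with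
    | _ a b =>
      have hab : G.Adj a b := he
      by_cases ha : a ∈ X
      · exact ⟨⟨(a, b), ha, hab⟩, rfl⟩
      · have hb : b ∈ X := by
          by_contra hb
          exact ha ((hbip a b hab).2 hb)
        exact ⟨⟨(b, a), hb, hab.symm⟩, Sym2.eq_swap⟩
  choose φ hφ using hex
  have hny : ∀ p : {p : V × V // p.1 ∈ X ∧ G.Adj p.1 p.2}, p.1.2 ∉ X :=
    fun p => (hbip _ _ p.2.2).1 p.2.1
  have hmem1 : ∀ (e : G.edgeSet) v, v ∈ (e : Sym2 V) → v ∈ X → (φ e).1.1 = v := by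
    intro e v hv hvX
    rw [hφ e, Sym2.mem_iff] at hv
    rcases hv with hv | hv
    · exact hv.symm
    · exact absurd (hv ▸ hvX) (hny (φ e))
  have hmem2 : ∀ (e : G.edgeSet) v, v ∈ (e : Sym2 V) → v ∉ X → (φ e).1.2 = v := by
    intro e v hv hvX
    rw [hφ e, Sym2.mem_iff] at hv
    rcases hv with hv | hv
    · exact absurd (hv ▸ (φ e).2.1) hvX
    · exact hv.symm
  refine ⟨fun e => c (φ e), ?_, fun e => h1 _, ?_⟩
  · intro e f hne hv
    obtain ⟨v, hve, hvf⟩ := hv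
    refine h2 _ _ ?_ ?_
    · intro h
      exact hne (Subtype.ext (by rw [hφ e, hφ f, h]))
    · by_cases hvX : v ∈ X
      · left; exact (hmem1 e v hve hvX).trans (hmem1 f v hvf hvX).symm
      · right; exact (hmem2 e v hve hvX).trans (hmem2 f v hvf hvX).symm
  · intro x hx a b m ha hb ham hmb
    obtain ⟨e, hxe, rfl⟩ := ha
    obtain ⟨f, hxf, rfl⟩ := hb
    have hue := hmem1 e x hxe hx
    have huf := hmem1 f x hxf hx
    obtain ⟨d, hd, hdm⟩ := h3 (φ e) (φ f) m (hue.trans huf.symm) ham hmb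
    have hdx : d.1.1 = x := Eq.trans hd hue
    have hxd : x ∈ s(d.1.1, d.1.2) := by rw [Sym2.mem_iff]; exact Or.inl hdx.symm
    refine ⟨⟨s(d.1.1, d.1.2), d.2.2⟩, hxd, ?_⟩
    have e1 := hmem1 ⟨s(d.1.1, d.1.2), d.2.2⟩ x hxd hx
    have e2 := hmem2 ⟨s(d.1.1, d.1.2), d.2.2⟩ d.1.2 (Sym2.mem_mk_right _ _) (hny d)
    have : φ ⟨s(d.1.1, d.1.2), d.2.2⟩ = d :=
      Subtype.ext (Prod.ext (e1.trans hdx.symm) e2)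
    dsimp only
    rw [this]; exact hdm
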